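/- arXiv:2408.13258 — 2 statements merged into one kernel-verified Lean document; each statement's English description precedes it below -/
import Mathlib

section
/- Let g be in normal form of order 2n+2, fix n ≥ 1, and assume a_{i,1} = 0 for 2 ≤ i ≤ n (no condition when n = 1), a_{n+1,1} ≠ 0, and a_{2,0} ≠ 0. Let φ : (−ε,ε) → ℝ be any C^∞ function with φ(0) = 0, φ^{(j)}(0) = 0 for 1 ≤ j ≤ n, and Σ(t, φ(t)) = 0 for all |t| < ε, and set L(t) = g(t, φ(t)). Then L'(0) × L''(0) ≠ 0, the unit binormal of L at 0 is b(0) = (0, −a_{2,0}, b₂)/√(a_{2,0}² + b₂²), the torsion of L at 0 is τ(0) = (a_{3,0} b₂ − a_{2,0} b₃)/(a_{2,0}² + b₂²), and its derivative at 0 is τ'(0) = −2(a_{3,0} b₂ − a_{2,0} b₃)(a_{2,0} a_{3,0} + b₂ b₃)/(a_{2,0}² + b₂²)² + (a_{4,0} a_{2,0} b₂ + 3 a_{2,1}² b₂² − a_{2,0}² b₄)/(a_{2,0}(a_{2,0}² + b₂²)). (For n ≥ 2 the term with a_{2,1} vanishes since a_{2,1} = 0.) -/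
open Real Set

noncomputable section

/-- Partial derivative in the first variable. -/
def pdu {F : Type*} [NormedAddCommGroup F] [NormedSpace ℝ F] (f : ℝ → ℝ → F) : ℝ → ℝ → F :=
  fun u w => deriv (fun t => f t w) u

/-- Partial derivative in the second variable. -/
def pdw {F : Type*} [NormedAddCommGroup F] [NormedSpace ℝ F] (f : ℝ → ℝ → F) : ℝ → ℝ → F :=
  fun u w => deriv (fun t => f u t) w

/-- Iterated partial derivative `∂_u^i ∂_w^j f`. -/
def pd {F : Type*} [NormedAddCommGroup F] [NormedSpace ℝ F] (i j : ℕ) (f : ℝ → ℝ → F) :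
    ℝ → ℝ → F :=
  pdu^[i] (pdw^[j] f)

/-- The Euclidean inner product on `ℝ³ = ℝ × ℝ × ℝ`. -/
def dot3 (x y : ℝ × ℝ × ℝ) : ℝ := x.1 * y.1 + x.2.1 * y.2.1 + x.2.2 * y.2.2

/-- The cross product on `ℝ³ = ℝ × ℝ × ℝ`. -/
def cross3 (x y : ℝ × ℝ × ℝ) : ℝ × ℝ × ℝ :=
  (x.2.1 * y.2.2 - x.2.2 * y.2.1, x.2.2 * y.1 - x.1 * y.2.2, x.1 * y.2.1 - x.2.1 * y.1)

/-- The Euclidean norm on `ℝ³ = ℝ × ℝ × ℝ`. -/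
def norm3 (x : ℝ × ℝ × ℝ) : ℝ := Real.sqrt (dot3 x x)

/-- The surface parameterization `g(u,w) = (u, p(u,w), q(u,w))`. -/
def gmap (p q : ℝ → ℝ → ℝ) : ℝ → ℝ → ℝ × ℝ × ℝ := fun u w => (u, p u w, q u w)

/-- The height function on the surface parameterized by `g = (u, p, q)` along `v`. -/
def hgt (p q : ℝ → ℝ → ℝ) (v : ℝ × ℝ × ℝ) : ℝ → ℝ → ℝ :=
  fun u w => dot3 (gmap p q u w) v

/-- `g = (u, p(u,w), q(u,w))` is in normal form of order `N`. -/
def NormalFormN (N : ℕ) (p q : ℝ → ℝ → ℝ) (b : ℕ → ℝ) (a : ℕ → ℕ → ℝ) : Prop :=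
  ContDiff ℝ (⊤ : ℕ∞) (fun x : ℝ × ℝ => p x.1 x.2) ∧
  ContDiff ℝ (⊤ : ℕ∞) (fun x : ℝ × ℝ => q x.1 x.2) ∧
  p 0 0 = 0 ∧ q 0 0 = 0 ∧
  pd 1 0 p 0 0 = 0 ∧ pd 0 1 p 0 0 = 0 ∧ pd 1 0 q 0 0 = 0 ∧ pd 0 1 q 0 0 = 0 ∧
  pd 0 2 p 0 0 = 1 ∧
  (∀ i, 2 ≤ i → i ≤ N → pd i 0 p 0 0 = b i) ∧
  (∀ i j, 2 ≤ i + j → i + j ≤ N → 1 ≤ j → ¬(i = 0 ∧ j = 2) → pd i j p 0 0 = 0) ∧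
  (∀ i j, 2 ≤ i + j → i + j ≤ N → pd i j q 0 0 = a i j) ∧
  a 1 1 = 0 ∧ a 0 2 = 0

/-- `h` has an `A_k` singularity at the origin: up to a `C^∞` change of coordinates fixing
the origin, `h` equals `h(0,0) ± x² ± y^(k+1)`. -/
def HasAkSingAt (h : ℝ → ℝ → ℝ) (k : ℕ) : Prop :=
  ∃ (U V : Set (ℝ × ℝ)) (φ ψ : ℝ × ℝ → ℝ × ℝ) (ε₁ ε₂ : ℝ),
    IsOpen U ∧ IsOpen V ∧ ((0, 0) : ℝ × ℝ) ∈ U ∧ ((0, 0) : ℝ × ℝ) ∈ V ∧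
    ContDiffOn ℝ (⊤ : ℕ∞) φ U ∧ ContDiffOn ℝ (⊤ : ℕ∞) ψ V ∧
    Set.MapsTo φ U V ∧ Set.MapsTo ψ V U ∧
    (∀ x ∈ U, ψ (φ x) = x) ∧ (∀ y ∈ V, φ (ψ y) = y) ∧
    φ (0, 0) = (0, 0) ∧ (ε₁ = 1 ∨ ε₁ = -1) ∧ (ε₂ = 1 ∨ ε₂ = -1) ∧
    ∀ x ∈ U, h (φ x).1 (φ x).2 = h 0 0 + ε₁ * x.1 ^ 2 + ε₂ * x.2 ^ (k + 1)

/-- The parabolic-set function `Σ = ⟨g_uu, g_u × g_w⟩⟨g_ww, g_u × g_w⟩ − ⟨g_uw, g_u × g_w⟩²`. -/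
def SigmaFun (p q : ℝ → ℝ → ℝ) : ℝ → ℝ → ℝ := fun u w =>
  dot3 (pd 2 0 (gmap p q) u w) (cross3 (pd 1 0 (gmap p q) u w) (pd 0 1 (gmap p q) u w)) *
      dot3 (pd 0 2 (gmap p q) u w) (cross3 (pd 1 0 (gmap p q) u w) (pd 0 1 (gmap p q) u w)) -
    dot3 (pd 1 1 (gmap p q) u w) (cross3 (pd 1 0 (gmap p q) u w) (pd 0 1 (gmap p q) u w)) ^ 2

/-- The torsion of a space curve `L`. -/
def tor (L : ℝ → ℝ × ℝ × ℝ) : ℝ → ℝ := fun t =>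
  dot3 (cross3 (deriv L t) (deriv (deriv L) t)) (deriv (deriv (deriv L)) t) /
    norm3 (cross3 (deriv L t) (deriv (deriv L) t)) ^ 2

/-- The unit binormal vector of a space curve `L` at `t = 0`. -/
def binormal0 (L : ℝ → ℝ × ℝ × ℝ) : ℝ × ℝ × ℝ :=
  (norm3 (cross3 (deriv L 0) (deriv (deriv L) 0)))⁻¹ • cross3 (deriv L 0) (deriv (deriv L) 0)

/-- `f` is a parabolic Monge form with `∂_w² f(0,0) = k₂ ≠ 0`. -/
def MongeForm (f : ℝ → ℝ → ℝ) (k₂ : ℝ) : Prop :=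
  ContDiff ℝ (⊤ : ℕ∞) (fun x : ℝ × ℝ => f x.1 x.2) ∧ f 0 0 = 0 ∧
  pd 1 0 f 0 0 = 0 ∧ pd 0 1 f 0 0 = 0 ∧
  pd 2 0 f 0 0 = 0 ∧ pd 1 1 f 0 0 = 0 ∧ pd 0 2 f 0 0 = k₂ ∧ k₂ ≠ 0

/-- The parabolic-set function `P = f_uu f_ww − f_uw²` of a Monge form. -/
def Pfun (f : ℝ → ℝ → ℝ) : ℝ → ℝ → ℝ := fun u w =>
  pd 2 0 f u w * pd 0 2 f u w - pd 1 1 f u w ^ 2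

/-- The partial derivative in the first variable as a directional derivative. -/
lemma hasDerivAt_pdu {f : ℝ → ℝ → ℝ} (hf : ContDiff ℝ (⊤ : ℕ∞) (fun x : ℝ × ℝ => f x.1 x.2))
    (u w : ℝ) :
    HasDerivAt (fun t => f t w) (fderiv ℝ (fun x : ℝ × ℝ => f x.1 x.2) (u, w) (1, 0)) u := by
  have h := (hf.differentiable (by simp) (u, w)).hasFDerivAt
  exact h.comp_hasDerivAt u ((hasDerivAt_id u).prodMk (hasDerivAt_const u w))

/-- The partial derivative in the second variable as a directional derivative. -/
lemma hasDerivAt_pdw {f : ℝ → ℝ → ℝ} (hf : ContDiff ℝ (⊤ : ℕ∞) (fun x : ℝ × ℝ => f x.1 x.2))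
    (u w : ℝ) :
    HasDerivAt (fun t => f u t) (fderiv ℝ (fun x : ℝ × ℝ => f x.1 x.2) (u, w) (0, 1)) w := by
  have h := (hf.differentiable (by simp) (u, w)).hasFDerivAt
  exact h.comp_hasDerivAt w ((hasDerivAt_const w u).prodMk (hasDerivAt_id w))

lemma pdu_eq_fderiv {f : ℝ → ℝ → ℝ} (hf : ContDiff ℝ (⊤ : ℕ∞) (fun x : ℝ × ℝ => f x.1 x.2)) :
    pdu f = fun u w => fderiv ℝ (fun x : ℝ × ℝ => f x.1 x.2) (u, w) (1, 0) := by
  funext u w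
  exact (hasDerivAt_pdu hf u w).deriv

lemma pdw_eq_fderiv {f : ℝ → ℝ → ℝ} (hf : ContDiff ℝ (⊤ : ℕ∞) (fun x : ℝ × ℝ => f x.1 x.2)) :
    pdw f = fun u w => fderiv ℝ (fun x : ℝ × ℝ => f x.1 x.2) (u, w) (0, 1) := by
  funext u w
  exact (hasDerivAt_pdw hf u w).deriv

lemma contDiff_fderiv_apply_const {F : ℝ × ℝ → ℝ} (hF : ContDiff ℝ (⊤ : ℕ∞) F) (v : ℝ × ℝ) :
    ContDiff ℝ (⊤ : ℕ∞) (fun x => fderiv ℝ F x v) :=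
  (hF.fderiv_right (by simp)).clm_apply contDiff_const

lemma contDiff_pdu {f : ℝ → ℝ → ℝ} (hf : ContDiff ℝ (⊤ : ℕ∞) (fun x : ℝ × ℝ => f x.1 x.2)) :
    ContDiff ℝ (⊤ : ℕ∞) (fun x : ℝ × ℝ => pdu f x.1 x.2) := by
  rw [pdu_eq_fderiv hf]
  exact contDiff_fderiv_apply_const hf (1, 0)

lemma contDiff_pdw {f : ℝ → ℝ → ℝ} (hf : ContDiff ℝ (⊤ : ℕ∞) (fun x : ℝ × ℝ => f x.1 x.2)) :
    ContDiff ℝ (⊤ : ℕ∞) (fun x : ℝ × ℝ => pdw f x.1 x.2) := by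
  rw [pdw_eq_fderiv hf]
  exact contDiff_fderiv_apply_const hf (0, 1)

/-- Partial derivatives of a smooth function commute. -/
lemma pdw_pdu {f : ℝ → ℝ → ℝ} (hf : ContDiff ℝ (⊤ : ℕ∞) (fun x : ℝ × ℝ => f x.1 x.2)) :
    pdw (pdu f) = pdu (pdw f) := by
  rw [pdw_eq_fderiv (contDiff_pdu hf), pdu_eq_fderiv (contDiff_pdw hf), pdu_eq_fderiv hf,
    pdw_eq_fderiv hf]
  funext u w
  have hd : DifferentiableAt ℝ (fderiv ℝ (fun x : ℝ × ℝ => f x.1 x.2)) (u, w) :=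
    (hf.fderiv_right (m := (⊤ : ℕ∞)) (by simp)).differentiable (by simp) _
  have key : ∀ v v' : ℝ × ℝ,
      fderiv ℝ (fun x : ℝ × ℝ => fderiv ℝ (fun x : ℝ × ℝ => f x.1 x.2) x v) (u, w) v' =
        fderiv ℝ (fderiv ℝ (fun x : ℝ × ℝ => f x.1 x.2)) (u, w) v' v := by
    intro v v'
    rw [fderiv_clm_apply hd (differentiableAt_const v)]
    simp
  have hs : IsSymmSndFDerivAt ℝ (fun x : ℝ × ℝ => f x.1 x.2) (u, w) :=
    hf.contDiffAt.isSymmSndFDerivAt (by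
      simpa using WithTop.coe_le_coe.mpr (le_top (a := (2 : ℕ∞))))
  exact (key (1, 0) (0, 1)).trans ((hs.eq _ _).trans (key (0, 1) (1, 0)).symm)

lemma contDiff_pd {f : ℝ → ℝ → ℝ} (hf : ContDiff ℝ (⊤ : ℕ∞) (fun x : ℝ × ℝ => f x.1 x.2))
    (i j : ℕ) : ContDiff ℝ (⊤ : ℕ∞) (fun x : ℝ × ℝ => pd i j f x.1 x.2) := by
  have hw : ContDiff ℝ (⊤ : ℕ∞) (fun x : ℝ × ℝ => pdw^[j] f x.1 x.2) := by
    induction j with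
    | zero => exact hf
    | succ j ih =>
      rw [Function.iterate_succ_apply']
      exact contDiff_pdw ih
  induction i with
  | zero => exact hw
  | succ i ih =>
    unfold pd at ih ⊢
    rw [Function.iterate_succ_apply']
    exact contDiff_pdu ih

lemma pdu_pd (f : ℝ → ℝ → ℝ) (i j : ℕ) : pdu (pd i j f) = pd (i + 1) j f :=
  (Function.iterate_succ_apply' pdu i _).symm

lemma pdw_pd {f : ℝ → ℝ → ℝ} (hf : ContDiff ℝ (⊤ : ℕ∞) (fun x : ℝ × ℝ => f x.1 x.2))
    (i j : ℕ) : pdw (pd i j f) = pd i (j + 1) f := by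
  induction i with
  | zero => exact (Function.iterate_succ_apply' pdw j f).symm
  | succ i ih => rw [← pdu_pd, pdw_pdu (contDiff_pd hf i j), ih, pdu_pd]

/-- The chain rule for a partial derivative along a graph `w = ψ t`. -/
lemma hasDerivAt_pd_graph {f : ℝ → ℝ → ℝ}
    (hf : ContDiff ℝ (⊤ : ℕ∞) (fun x : ℝ × ℝ => f x.1 x.2)) (i j : ℕ) {ψ : ℝ → ℝ} {ψ' t : ℝ}
    (hψ : HasDerivAt ψ ψ' t) :
    HasDerivAt (fun s => pd i j f s (ψ s))
      (pd (i + 1) j f t (ψ t) + pd i (j + 1) f t (ψ t) * ψ') t := by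
  have hc := contDiff_pd hf i j
  have h := ((hc.differentiable (by simp) (t, ψ t)).hasFDerivAt).comp_hasDerivAt t
    ((hasDerivAt_id t).prodMk hψ)
  refine h.congr_deriv ?_
  rw [← pdu_pd, ← pdw_pd hf, pdu_eq_fderiv hc, pdw_eq_fderiv hc]
  have hv : ((1, ψ') : ℝ × ℝ) = (1, 0) + ψ' • (0, 1) := by simp
  rw [hv, map_add, map_smul, smul_eq_mul, mul_comm ψ']

/-- Explicit first three derivatives of `t ↦ f t (ψ t)`, and its fourth derivative at `0`. -/
lemma hasDerivAt_graph {f : ℝ → ℝ → ℝ}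
    (hf : ContDiff ℝ (⊤ : ℕ∞) (fun x : ℝ × ℝ => f x.1 x.2)) {ψ ψ₁ ψ₂ ψ₃ ψ₄ : ℝ → ℝ}
    (h₀ : ∀ t, HasDerivAt ψ (ψ₁ t) t) (h₁ : ∀ t, HasDerivAt ψ₁ (ψ₂ t) t)
    (h₂ : ∀ t, HasDerivAt ψ₂ (ψ₃ t) t) (h₃ : ∀ t, HasDerivAt ψ₃ (ψ₄ t) t)
    (hz : ψ 0 = 0) (hz₁ : ψ₁ 0 = 0) :
    ∃ P₁ P₂ P₃ : ℝ → ℝ, (∀ t, HasDerivAt (fun s => f s (ψ s)) (P₁ t) t) ∧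
      (∀ t, HasDerivAt P₁ (P₂ t) t) ∧ (∀ t, HasDerivAt P₂ (P₃ t) t) ∧
      HasDerivAt P₃ (pd 4 0 f 0 0 + 6 * pd 2 1 f 0 0 * ψ₂ 0 + 4 * pd 1 1 f 0 0 * ψ₃ 0 +
        3 * pd 0 2 f 0 0 * ψ₂ 0 ^ 2 + pd 0 1 f 0 0 * ψ₄ 0) 0 ∧
      P₁ 0 = pd 1 0 f 0 0 ∧ P₂ 0 = pd 2 0 f 0 0 + pd 0 1 f 0 0 * ψ₂ 0 ∧
      P₃ 0 = pd 3 0 f 0 0 + 3 * pd 1 1 f 0 0 * ψ₂ 0 + pd 0 1 f 0 0 * ψ₃ 0 := by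
  have F := fun i j t => hasDerivAt_pd_graph hf i j (h₀ t)
  refine ⟨fun t => pd 1 0 f t (ψ t) + pd 0 1 f t (ψ t) * ψ₁ t,
    fun t => pd 2 0 f t (ψ t) + 2 * (pd 1 1 f t (ψ t) * ψ₁ t) +
      pd 0 2 f t (ψ t) * (ψ₁ t * ψ₁ t) + pd 0 1 f t (ψ t) * ψ₂ t,
    fun t => pd 3 0 f t (ψ t) + 3 * (pd 2 1 f t (ψ t) * ψ₁ t) +
      3 * (pd 1 2 f t (ψ t) * (ψ₁ t * ψ₁ t)) +
      pd 0 3 f t (ψ t) * (ψ₁ t * (ψ₁ t * ψ₁ t)) + 3 * (pd 1 1 f t (ψ t) * ψ₂ t) +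
      3 * (pd 0 2 f t (ψ t) * (ψ₁ t * ψ₂ t)) + pd 0 1 f t (ψ t) * ψ₃ t,
    fun t => F 0 0 t, fun t => ?_, fun t => ?_, ?_, ?_, ?_, ?_⟩
  · refine ((F 1 0 t).add ((F 0 1 t).mul (h₁ t))).congr_deriv ?_
    ring
  · refine ((((F 2 0 t).add (((F 1 1 t).mul (h₁ t)).const_mul 2)).add
      ((F 0 2 t).mul ((h₁ t).mul (h₁ t)))).add ((F 0 1 t).mul (h₂ t))).congr_deriv ?_
    simp only [Pi.mul_apply]
    ring
  · refine (((((((F 3 0 0).add (((F 2 1 0).mul (h₁ 0)).const_mul 3)).add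
      (((F 1 2 0).mul ((h₁ 0).mul (h₁ 0))).const_mul 3)).add
      ((F 0 3 0).mul ((h₁ 0).mul ((h₁ 0).mul (h₁ 0))))).add
      (((F 1 1 0).mul (h₂ 0)).const_mul 3)).add
      (((F 0 2 0).mul ((h₁ 0).mul (h₂ 0))).const_mul 3)).add
      ((F 0 1 0).mul (h₃ 0))).congr_deriv ?_
    simp only [Pi.mul_apply, hz, hz₁]
    ring
  · simp [hz, hz₁]
  · simp [hz, hz₁]
  · simp only [hz, hz₁]
    ring

/-- Torsion data at `0` of the curve `t ↦ (t, P t, Q t)` when `P' (0) = Q' (0) = 0`. -/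
lemma torsion_graph {P Q P₁ P₂ P₃ Q₁ Q₂ Q₃ : ℝ → ℝ} {P₄ Q₄ : ℝ}
    (hP : ∀ t, HasDerivAt P (P₁ t) t) (hP₁ : ∀ t, HasDerivAt P₁ (P₂ t) t)
    (hP₂ : ∀ t, HasDerivAt P₂ (P₃ t) t) (hP₃ : HasDerivAt P₃ P₄ 0)
    (hQ : ∀ t, HasDerivAt Q (Q₁ t) t) (hQ₁ : ∀ t, HasDerivAt Q₁ (Q₂ t) t)
    (hQ₂ : ∀ t, HasDerivAt Q₂ (Q₃ t) t) (hQ₃ : HasDerivAt Q₃ Q₄ 0)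
    (hzP : P₁ 0 = 0) (hzQ : Q₁ 0 = 0) (hne : Q₂ 0 ≠ 0) :
    let L : ℝ → ℝ × ℝ × ℝ := fun t => (t, P t, Q t)
    cross3 (deriv L 0) (deriv (deriv L) 0) = (0, -Q₂ 0, P₂ 0) ∧
    tor L 0 = (P₂ 0 * Q₃ 0 - Q₂ 0 * P₃ 0) / (Q₂ 0 ^ 2 + P₂ 0 ^ 2) ∧
    deriv (tor L) 0 =
      ((P₂ 0 * Q₄ - Q₂ 0 * P₄) * (Q₂ 0 ^ 2 + P₂ 0 ^ 2) -
        (P₂ 0 * Q₃ 0 - Q₂ 0 * P₃ 0) * (2 * (Q₂ 0 * Q₃ 0 + P₂ 0 * P₃ 0))) /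
        (Q₂ 0 ^ 2 + P₂ 0 ^ 2) ^ 2 := by
  intro L
  have hL₁ : deriv L = fun t => (1, P₁ t, Q₁ t) := by
    funext t
    exact ((hasDerivAt_id t).prodMk ((hP t).prodMk (hQ t))).deriv
  have hL₂ : deriv (deriv L) = fun t => (0, P₂ t, Q₂ t) := by
    rw [hL₁]
    funext t
    exact ((hasDerivAt_const t (1 : ℝ)).prodMk ((hP₁ t).prodMk (hQ₁ t))).deriv
  have hL₃ : deriv (deriv (deriv L)) = fun t => (0, P₃ t, Q₃ t) := by
    rw [hL₂]
    funext t
    exact ((hasDerivAt_const t (0 : ℝ)).prodMk ((hP₂ t).prodMk (hQ₂ t))).deriv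
  have htor : tor L = fun t => (P₂ t * Q₃ t - Q₂ t * P₃ t) /
      ((P₁ t * Q₂ t - Q₁ t * P₂ t) * (P₁ t * Q₂ t - Q₁ t * P₂ t) + Q₂ t * Q₂ t +
        P₂ t * P₂ t) := by
    funext t
    unfold tor norm3
    rw [hL₃, hL₂, hL₁]
    simp only [dot3, cross3]
    rw [Real.sq_sqrt (add_nonneg (add_nonneg (mul_self_nonneg _) (mul_self_nonneg _))
      (mul_self_nonneg _))]
    congr 1 <;> ring
  refine ⟨?_, ?_, ?_⟩
  · rw [hL₂, hL₁]
    simp [cross3, hzP, hzQ]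
  · rw [htor]
    simp only [hzP, hzQ]
    congr 1
    ring
  · have hN : (P₁ 0 * Q₂ 0 - Q₁ 0 * P₂ 0) * (P₁ 0 * Q₂ 0 - Q₁ 0 * P₂ 0) + Q₂ 0 * Q₂ 0 +
        P₂ 0 * P₂ 0 ≠ 0 := by
      rw [hzP, hzQ]
      have := mul_self_pos.mpr hne
      nlinarith [mul_self_nonneg (P₂ 0)]
    have hX := ((hP₁ 0).mul (hQ₂ 0)).sub ((hQ₁ 0).mul (hP₂ 0))
    have hd := (((hP₂ 0).mul hQ₃).sub ((hQ₂ 0).mul hP₃)).div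
      (((hX.mul hX).add ((hQ₂ 0).mul (hQ₂ 0))).add ((hP₂ 0).mul (hP₂ 0))) hN
    rw [htor]
    refine hd.deriv.trans ?_
    simp only [Pi.mul_apply, Pi.sub_apply, Pi.add_apply, hzP, hzQ]
    congr 1 <;> ring

/-- Second-order Taylor limit at `0`. -/
lemma tendsto_div_sq {X X₁ : ℝ → ℝ} {c : ℝ} (h₀ : ∀ t, HasDerivAt X (X₁ t) t)
    (h₁ : HasDerivAt X₁ c 0) (hz : X 0 = 0) (hz₁ : X₁ 0 = 0) :
    Filter.Tendsto (fun t => X t / t ^ 2) (nhdsWithin 0 {0}ᶜ) (nhds (c / 2)) := by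
  have hslope : Filter.Tendsto (fun t => X₁ t / (2 * t)) (nhdsWithin 0 {0}ᶜ) (nhds (c / 2)) := by
    have h := (hasDerivAt_iff_tendsto_slope.mp h₁).div_const 2
    refine h.congr fun t => ?_
    rw [slope_def_field, hz₁, sub_zero, sub_zero, div_div, mul_comm t]
  refine HasDerivAt.lhopital_zero_nhdsNE (f' := X₁) (g' := fun t => 2 * t)
    (Filter.Eventually.of_forall h₀) (Filter.Eventually.of_forall fun t => ?_) ?_ ?_ ?_ hslope
  · simpa using hasDerivAt_pow 2 t
  · filter_upwards [self_mem_nhdsWithin] with t ht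
    exact mul_ne_zero two_ne_zero ht
  · have h := (h₀ 0).continuousAt.tendsto
    rw [hz] at h
    exact h.mono_left nhdsWithin_le_nhds
  · have h : Filter.Tendsto (fun t : ℝ => t ^ 2) (nhds 0) (nhds (0 ^ 2)) :=
      (continuous_pow 2).tendsto 0
    rw [zero_pow two_ne_zero] at h
    exact h.mono_left nhdsWithin_le_nhds

/-- The parabolic-set function in terms of the partial derivatives of `p` and `q`. -/
lemma sigmaFun_eq {p q : ℝ → ℝ → ℝ} (hp : ContDiff ℝ (⊤ : ℕ∞) (fun x : ℝ × ℝ => p x.1 x.2))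
    (hq : ContDiff ℝ (⊤ : ℕ∞) (fun x : ℝ × ℝ => q x.1 x.2)) (u w : ℝ) :
    SigmaFun p q u w =
      (pd 0 1 p u w * pd 2 0 q u w - pd 0 1 q u w * pd 2 0 p u w) *
        (pd 0 1 p u w * pd 0 2 q u w - pd 0 1 q u w * pd 0 2 p u w) -
      (pd 0 1 p u w * pd 1 1 q u w - pd 0 1 q u w * pd 1 1 p u w) ^ 2 := by
  have hu : ∀ {f : ℝ → ℝ → ℝ}, ContDiff ℝ (⊤ : ℕ∞) (fun x : ℝ × ℝ => f x.1 x.2) →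
      ∀ u w, HasDerivAt (fun t => f t w) (pdu f u w) u := fun hf u w =>
    (hasDerivAt_pdu hf u w).differentiableAt.hasDerivAt
  have hw : ∀ {f : ℝ → ℝ → ℝ}, ContDiff ℝ (⊤ : ℕ∞) (fun x : ℝ × ℝ => f x.1 x.2) →
      ∀ u w, HasDerivAt (fun t => f u t) (pdw f u w) w := fun hf u w =>
    (hasDerivAt_pdw hf u w).differentiableAt.hasDerivAt
  have hgu : pdu (gmap p q) = fun u w => (1, pdu p u w, pdu q u w) := by
    funext u w
    exact ((hasDerivAt_id u).prodMk ((hu hp u w).prodMk (hu hq u w))).deriv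
  have hgw : pdw (gmap p q) = fun u w => (0, pdw p u w, pdw q u w) := by
    funext u w
    exact ((hasDerivAt_const w u).prodMk ((hw hp u w).prodMk (hw hq u w))).deriv
  have hguu : pdu (pdu (gmap p q)) = fun u w => (0, pdu (pdu p) u w, pdu (pdu q) u w) := by
    rw [hgu]
    funext u w
    exact ((hasDerivAt_const u (1 : ℝ)).prodMk ((hu (contDiff_pdu hp) u w).prodMk
      (hu (contDiff_pdu hq) u w))).deriv
  have hguw : pdu (pdw (gmap p q)) = fun u w => (0, pdu (pdw p) u w, pdu (pdw q) u w) := by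
    rw [hgw]
    funext u w
    exact ((hasDerivAt_const u (0 : ℝ)).prodMk ((hu (contDiff_pdw hp) u w).prodMk
      (hu (contDiff_pdw hq) u w))).deriv
  have hgww : pdw (pdw (gmap p q)) = fun u w => (0, pdw (pdw p) u w, pdw (pdw q) u w) := by
    rw [hgw]
    funext u w
    exact ((hasDerivAt_const w (0 : ℝ)).prodMk ((hw (contDiff_pdw hp) u w).prodMk
      (hw (contDiff_pdw hq) u w))).deriv
  simp only [SigmaFun, pd, Function.iterate_succ, Function.iterate_zero, Function.comp_apply,
    id_eq]
  rw [hguu, hguw, hgww, hgu, hgw]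
  simp only [dot3, cross3]
  ring

/-- The parabolic equation determines the second derivative of a branch tangent to the
`u`-axis when `q_uuw (0, 0) ≠ 0`. -/
lemma second_deriv_of_parabolic_branch {p q : ℝ → ℝ → ℝ}
    (hp : ContDiff ℝ (⊤ : ℕ∞) (fun x : ℝ × ℝ => p x.1 x.2))
    (hq : ContDiff ℝ (⊤ : ℕ∞) (fun x : ℝ × ℝ => q x.1 x.2)) {ψ ψ₁ ψ₂ : ℝ → ℝ}
    (h₀ : ∀ t, HasDerivAt ψ (ψ₁ t) t) (h₁ : ∀ t, HasDerivAt ψ₁ (ψ₂ t) t)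
    (hz : ψ 0 = 0) (hz₁ : ψ₁ 0 = 0) (hp01 : pd 0 1 p 0 0 = 0) (hq01 : pd 0 1 q 0 0 = 0)
    (hp11 : pd 1 1 p 0 0 = 0) (hq11 : pd 1 1 q 0 0 = 0) (hp02 : pd 0 2 p 0 0 = 1)
    (hq02 : pd 0 2 q 0 0 = 0) (hp21 : pd 2 1 p 0 0 = 0) (hq21 : pd 2 1 q 0 0 ≠ 0)
    (hSig : ∀ᶠ t in nhds (0 : ℝ), SigmaFun p q t (ψ t) = 0) :
    pd 2 0 q 0 0 * ψ₂ 0 = pd 2 1 q 0 0 * pd 2 0 p 0 0 := by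
  have hlim : ∀ {f : ℝ → ℝ → ℝ}, ContDiff ℝ (⊤ : ℕ∞) (fun x : ℝ × ℝ => f x.1 x.2) →
      pd 0 1 f 0 0 = 0 → pd 1 1 f 0 0 = 0 →
      Filter.Tendsto (fun t => pd 0 1 f t (ψ t) / t ^ 2) (nhdsWithin 0 {0}ᶜ)
        (nhds ((pd 2 1 f 0 0 + pd 0 2 f 0 0 * ψ₂ 0) / 2)) := by
    intro f hf hf01 hf11
    refine tendsto_div_sq (fun t => hasDerivAt_pd_graph hf 0 1 (h₀ t))
      (((hasDerivAt_pd_graph hf 1 1 (h₀ 0)).add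
        ((hasDerivAt_pd_graph hf 0 2 (h₀ 0)).mul (h₁ 0))).congr_deriv ?_) ?_ ?_
    · simp [hz, hz₁]
    · simp [hz, hf01]
    · simp [hz, hz₁, hf11]
  have hcont : ∀ {f : ℝ → ℝ → ℝ}, ContDiff ℝ (⊤ : ℕ∞) (fun x : ℝ × ℝ => f x.1 x.2) →
      ∀ i j, Filter.Tendsto (fun t => pd i j f t (ψ t)) (nhdsWithin 0 {0}ᶜ)
        (nhds (pd i j f 0 0)) := by
    intro f hf i j
    have h := (hasDerivAt_pd_graph hf i j (h₀ 0)).continuousAt.tendsto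
    rw [hz] at h
    exact h.mono_left nhdsWithin_le_nhds
  have hP := hlim hp hp01 hp11
  have hQ := hlim hq hq01 hq11
  have hA := (hP.mul (hcont hq 2 0)).sub (hQ.mul (hcont hp 2 0))
  have hB := (hP.mul (hcont hq 0 2)).sub (hQ.mul (hcont hp 0 2))
  have hC := (hP.mul (hcont hq 1 1)).sub (hQ.mul (hcont hp 1 1))
  have hS := (hA.mul hB).sub (hC.pow 2)
  have hzero := hS.congr' (f₂ := fun _ => (0 : ℝ)) (by
    filter_upwards [hSig.filter_mono nhdsWithin_le_nhds, self_mem_nhdsWithin] with t ht ht0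
    have ht0 : t ≠ 0 := ht0
    rw [sigmaFun_eq hp hq] at ht
    have hdiv := congrArg (fun x => x / t ^ 4) ht
    simp only [zero_div] at hdiv
    rw [← hdiv]
    field_simp)
  have heq := tendsto_nhds_unique hzero tendsto_const_nhds
  rw [hp21, hp02, hq02, hp11, hq11] at heq
  have hfac : pd 2 1 q 0 0 * (pd 2 0 q 0 0 * ψ₂ 0 - pd 2 1 q 0 0 * pd 2 0 p 0 0) = 0 := by
    linear_combination -4 * heq
  exact sub_eq_zero.mp ((mul_eq_zero.mp hfac).resolve_left hq21)

/-- A function smooth on an interval around `0` has the same germ at `0` as a globally smooth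
function. -/
lemma exists_contDiff_eventuallyEq {φ : ℝ → ℝ} {ε : ℝ} (hε : 0 < ε)
    (hφ : ContDiffOn ℝ (⊤ : ℕ∞) φ (Set.Ioo (-ε) ε)) :
    ∃ ψ : ℝ → ℝ, ContDiff ℝ (⊤ : ℕ∞) ψ ∧ ψ =ᶠ[nhds 0] φ := by
  let β : ContDiffBump (0 : ℝ) := ⟨ε / 3, ε / 2, by positivity, by linarith⟩
  refine ⟨fun t => β t * φ t, contDiff_iff_contDiffAt.mpr fun t => ?_, ?_⟩
  · by_cases ht : t ∈ Set.Ioo (-ε) ε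
    · exact β.contDiff.contDiffAt.mul (hφ.contDiffAt (Ioo_mem_nhds ht.1 ht.2))
    · have hts : t ∉ tsupport β := by
        rw [β.tsupport_eq, Metric.mem_closedBall, Real.dist_0_eq_abs]
        intro h
        have h : |t| ≤ ε / 2 := h
        rw [abs_le] at h
        exact ht ⟨by linarith [h.1], by linarith [h.2]⟩
      refine (contDiffAt_const (c := (0 : ℝ))).congr_of_eventuallyEq ?_
      filter_upwards [notMem_tsupport_iff_eventuallyEq.mp hts] with s hs
      simp [hs]
  · filter_upwards [β.eventuallyEq_one] with s hs
    simp [hs]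

/-- for a branch `L(t) = g(t, φ(t))` of the parabolic set through the
singularity, the binormal, torsion and derivative of torsion at `0` are as stated. -/
theorem torsion_of_parabolic_branch (p q : ℝ → ℝ → ℝ) (b : ℕ → ℝ) (a : ℕ → ℕ → ℝ)
    (n : ℕ) (hn : 1 ≤ n) (hNF : NormalFormN (2 * n + 2) p q b a)
    (hvan : ∀ i, 2 ≤ i → i ≤ n → a i 1 = 0) (hnz : a (n + 1) 1 ≠ 0) (ha20 : a 2 0 ≠ 0)
    (ε : ℝ) (hε : 0 < ε) (φ : ℝ → ℝ) (hφ : ContDiffOn ℝ (⊤ : ℕ∞) φ (Set.Ioo (-ε) ε))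
    (hφ0 : φ 0 = 0) (hφj : ∀ j, 1 ≤ j → j ≤ n → iteratedDeriv j φ 0 = 0)
    (hSig : ∀ t : ℝ, |t| < ε → SigmaFun p q t (φ t) = 0) :
    let L : ℝ → ℝ × ℝ × ℝ := fun t => gmap p q t (φ t)
    cross3 (deriv L 0) (deriv (deriv L) 0) ≠ 0 ∧
    binormal0 L =
      (Real.sqrt (a 2 0 ^ 2 + b 2 ^ 2))⁻¹ • (((0 : ℝ), -(a 2 0), b 2) : ℝ × ℝ × ℝ) ∧
    tor L 0 = (a 3 0 * b 2 - a 2 0 * b 3) / (a 2 0 ^ 2 + b 2 ^ 2) ∧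
    deriv (tor L) 0 =
      -(2 * (a 3 0 * b 2 - a 2 0 * b 3) * (a 2 0 * a 3 0 + b 2 * b 3)) /
          (a 2 0 ^ 2 + b 2 ^ 2) ^ 2 +
        (a 4 0 * a 2 0 * b 2 + 3 * a 2 1 ^ 2 * b 2 ^ 2 - a 2 0 ^ 2 * b 4) /
          (a 2 0 * (a 2 0 ^ 2 + b 2 ^ 2)) := by
  obtain ⟨hp, hq, -, -, hp10, hp01, hq10, hq01, hp02, hpb, hp0, hqa, ha11, ha02⟩ := hNF
  obtain ⟨ψ, hψ, hψφ⟩ := exists_contDiff_eventuallyEq hε hφ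
  have hsm : ∀ k, ∀ t, HasDerivAt (deriv^[k] ψ) (deriv^[k + 1] ψ t) t := by
    intro k t
    have h : ContDiff ℝ (⊤ : ℕ∞) (deriv^[k] ψ) := hψ.iterate_deriv k
    rw [Function.iterate_succ_apply']
    exact (h.differentiable (by simp) t).hasDerivAt
  have hj : ∀ j, 1 ≤ j → j ≤ n → deriv^[j] ψ 0 = 0 := by
    intro j h1 h2
    rw [← iteratedDeriv_eq_iterate, hψφ.iteratedDeriv_eq, hφj j h1 h2]
  have hz : ψ 0 = 0 := hψφ.eq_of_nhds.trans hφ0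
  have hz₁ : deriv^[1] ψ 0 = 0 := hj 1 le_rfl hn
  have hq11 : pd 1 1 q 0 0 = 0 := by rw [hqa 1 1 (by omega) (by omega), ha11]
  have hq02 : pd 0 2 q 0 0 = 0 := by rw [hqa 0 2 (by omega) (by omega), ha02]
  have hp11 : pd 1 1 p 0 0 = 0 := hp0 1 1 (by omega) (by omega) (by omega) (by omega)
  have hp21 : pd 2 1 p 0 0 = 0 := hp0 2 1 (by omega) (by omega) (by omega) (by omega)
  have hq20 := hqa 2 0 (by omega) (by omega)
  have hq21 := hqa 2 1 (by omega) (by omega)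
  have hq30 := hqa 3 0 (by omega) (by omega)
  have hq40 := hqa 4 0 (by omega) (by omega)
  have hp20 := hpb 2 (by omega) (by omega)
  have hp30 := hpb 3 (by omega) (by omega)
  have hp40 := hpb 4 (by omega) (by omega)
  have hc : a 2 0 * deriv^[2] ψ 0 = a 2 1 * b 2 := by
    rcases hn.eq_or_lt with rfl | hn2
    · have h := second_deriv_of_parabolic_branch hp hq (hsm 0) (hsm 1) hz hz₁ hp01 hq01 hp11
        hq11 hp02 hq02 hp21 (by rwa [hq21]) (by
          filter_upwards [hψφ, Metric.ball_mem_nhds (0 : ℝ) hε] with t ht htε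
          change SigmaFun p q t (ψ t) = 0
          rw [ht]
          exact hSig t (by simpa using htε))
      rwa [hq20, hq21, hp20] at h
    · rw [hj 2 (by omega) hn2, hvan 2 le_rfl hn2]
      ring
  have hN : a 2 0 ^ 2 + b 2 ^ 2 ≠ 0 := by positivity
  intro L
  obtain ⟨P₁, P₂, P₃, hP, hP₁, hP₂, hP₃, eP₁, eP₂, eP₃⟩ :=
    hasDerivAt_graph hp (hsm 0) (hsm 1) (hsm 2) (hsm 3) hz hz₁
  obtain ⟨Q₁, Q₂, Q₃, hQ, hQ₁, hQ₂, hQ₃, eQ₁, eQ₂, eQ₃⟩ :=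
    hasDerivAt_graph hq (hsm 0) (hsm 1) (hsm 2) (hsm 3) hz hz₁
  simp only [hp10, hp01, hp02, hp11, hp21, hp20, hp30, hp40, zero_mul, mul_zero, add_zero,
    mul_one] at hP₃ eP₁ eP₂ eP₃
  simp only [hq10, hq01, hq02, hq11, hq21, hq20, hq30, hq40, zero_mul, mul_zero, add_zero]
    at hQ₃ eQ₁ eQ₂ eQ₃
  obtain ⟨hcross, htor, hdtor⟩ :=
    torsion_graph hP hP₁ hP₂ hP₃ hQ hQ₁ hQ₂ hQ₃ eP₁ eQ₁ (by rwa [eQ₂])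
  have hL : L =ᶠ[nhds 0] fun t => (t, p t (deriv^[0] ψ t), q t (deriv^[0] ψ t)) := by
    filter_upwards [hψφ] with t ht
    change gmap p q t (φ t) = gmap p q t (ψ t)
    rw [ht]
  have htorL : tor L =ᶠ[nhds 0]
      tor fun t => (t, p t (deriv^[0] ψ t), q t (deriv^[0] ψ t)) := by
    filter_upwards [hL.deriv, hL.deriv.deriv, hL.deriv.deriv.deriv] with t h₁ h₂ h₃
    unfold tor
    rw [h₁, h₂, h₃]
  rw [← hL.deriv_eq, ← hL.deriv.deriv_eq, eP₂, eQ₂] at hcross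
  rw [← htorL.eq_of_nhds, eP₂, eQ₂, eP₃, eQ₃] at htor
  rw [← htorL.deriv_eq, eP₂, eQ₂, eP₃, eQ₃] at hdtor
  refine ⟨?_, ?_, ?_, ?_⟩
  · rw [hcross]
    simp [ha20]
  · unfold binormal0 norm3
    rw [hcross]
    simp only [dot3]
    congr 3
    ring
  · rw [htor]
    congr 1
    ring
  · rw [hdtor]
    have hc' : deriv^[2] ψ 0 = a 2 1 * b 2 / a 2 0 := by
      field_simp
      linear_combination hc
    rw [hc']
    field_simp
    ring
end
end

section
/- Let f be a parabolic Monge form with (a_{3,0}, a_{2,1}) ≠ (0,0). Let c = (c₁,c₂) : (−ε,ε) → ℝ² be C^∞ with c(0) = (0,0), c'(0) ≠ (0,0) and P(c(t)) = 0 for all |t| < ε, set L(t) = (c₁(t), c₂(t), f(c(t))), and assume L'(0) × L''(0) ≠ 0. Then f does NOT have an A₂ singularity at (0,0) if and only if the unit binormal b(0) of L at 0 equals ±(0,0,1); moreover, if b(0) = ±(0,0,1), then the torsion of L satisfies τ(0) = 0. -/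
open Real Set

noncomputable section

open MeasureTheory Filter Topology

theorem hasFDerivAt_integral_param {E G : Type} [NormedAddCommGroup E] [NormedSpace ℝ E]
    [ProperSpace E] [NormedAddCommGroup G] [NormedSpace ℝ G] [CompleteSpace G] {F : E × ℝ → G}
    (hF : ContDiff ℝ 1 F) (p : E) :
    HasFDerivAt (fun p => ∫ s in (0 : ℝ)..1, F (p, s))
      (∫ s in (0 : ℝ)..1, (fderiv ℝ F (p, s)).comp (ContinuousLinearMap.inl ℝ E ℝ)) p := by
  have hcont : Continuous fun x : E × ℝ =>
      (fderiv ℝ F x).comp (ContinuousLinearMap.inl ℝ E ℝ) :=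
    (hF.continuous_fderiv one_ne_zero).clm_comp continuous_const
  obtain ⟨C, hC⟩ := ((isCompact_closedBall p 1).prod
    (isCompact_Icc (a := (0 : ℝ)) (b := 1))).exists_bound_of_continuousOn hcont.continuousOn
  refine intervalIntegral.hasFDerivAt_integral_of_dominated_of_fderiv_le
    (F := fun p s => F (p, s))
    (F' := fun p s => (fderiv ℝ F (p, s)).comp (ContinuousLinearMap.inl ℝ E ℝ))
    (bound := fun _ => C) (Metric.closedBall_mem_nhds p one_pos) ?_ ?_ ?_ ?_ ?_ ?_
  · exact Eventually.of_forall fun x =>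
      (hF.continuous.comp (by fun_prop : Continuous fun s : ℝ => (x, s))).aestronglyMeasurable
  · exact (hF.continuous.comp (by fun_prop : Continuous fun s : ℝ => (p, s))).intervalIntegrable _ _
  · exact (hcont.comp (by fun_prop : Continuous fun s : ℝ => (p, s))).aestronglyMeasurable
  · refine Eventually.of_forall fun s hs x hx => hC (x, s) ⟨hx, ?_⟩
    rw [uIoc_of_le zero_le_one] at hs
    exact ⟨hs.1.le, hs.2⟩
  · exact intervalIntegrable_const
  · refine Eventually.of_forall fun s _ x _ => ?_
    have h1 : HasFDerivAt F (fderiv ℝ F (x, s)) (x, s) :=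
      (hF.differentiable one_ne_zero _).hasFDerivAt
    exact h1.comp x (hasFDerivAt_prodMk_left x s)

theorem contDiff_nat_integral_param {E : Type} [NormedAddCommGroup E] [NormedSpace ℝ E]
    [ProperSpace E] (n : ℕ) {G : Type} [NormedAddCommGroup G] [NormedSpace ℝ G] [CompleteSpace G]
    {F : E × ℝ → G} (hF : ContDiff ℝ (⊤ : ℕ∞) F) :
    ContDiff ℝ n (fun p => ∫ s in (0 : ℝ)..1, F (p, s)) := by
  induction n generalizing G with
  | zero =>
    exact contDiff_zero.2 (Differentiable.continuous (𝕜 := ℝ) fun p =>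
      (hasFDerivAt_integral_param (hF.of_le (by exact_mod_cast le_top)) p).differentiableAt)
  | succ n ih =>
    have hd := hasFDerivAt_integral_param (hF.of_le (by exact_mod_cast le_top) : ContDiff ℝ 1 F)
    push_cast
    rw [contDiff_succ_iff_fderiv]
    refine ⟨fun p => (hd p).differentiableAt, by simp, ?_⟩
    rw [show fderiv ℝ (fun p => ∫ s in (0 : ℝ)..1, F (p, s)) = _ from funext fun p => (hd p).fderiv]
    exact ih (F := fun x => (fderiv ℝ F x).comp (ContinuousLinearMap.inl ℝ E ℝ))
      ((hF.fderiv_right (by simp)).clm_comp contDiff_const)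

theorem contDiff_integral_param {E G : Type} [NormedAddCommGroup E] [NormedSpace ℝ E]
    [ProperSpace E] [NormedAddCommGroup G] [NormedSpace ℝ G] [CompleteSpace G]
    {F : E × ℝ → G} (hF : ContDiff ℝ (⊤ : ℕ∞) F) :
    ContDiff ℝ (⊤ : ℕ∞) (fun p => ∫ s in (0 : ℝ)..1, F (p, s)) :=
  contDiff_infty.2 fun n => contDiff_nat_integral_param n hF

/-- A function of two variables that is jointly `C^∞`. -/
def Smooth2 (f : ℝ → ℝ → ℝ) : Prop := ContDiff ℝ (⊤ : ℕ∞) (fun x : ℝ × ℝ => f x.1 x.2)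

namespace Smooth2

variable {f : ℝ → ℝ → ℝ}

theorem differentiable (hf : Smooth2 f) : Differentiable ℝ (fun x : ℝ × ℝ => f x.1 x.2) :=
  ContDiff.differentiable hf (by simp)

theorem pdu_eq (hf : Smooth2 f) (u w : ℝ) :
    pdu f u w = fderiv ℝ (fun x : ℝ × ℝ => f x.1 x.2) (u, w) (1, 0) := by
  have h := (hf.differentiable (u, w)).hasFDerivAt.comp_hasDerivAt u
    ((hasDerivAt_id u).prodMk (hasDerivAt_const u w))
  exact h.deriv

theorem pdw_eq (hf : Smooth2 f) (u w : ℝ) :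
    pdw f u w = fderiv ℝ (fun x : ℝ × ℝ => f x.1 x.2) (u, w) (0, 1) := by
  have h := (hf.differentiable (u, w)).hasFDerivAt.comp_hasDerivAt w
    ((hasDerivAt_const w u).prodMk (hasDerivAt_id w))
  exact h.deriv

theorem smooth_pdu (hf : Smooth2 f) : Smooth2 (pdu f) := by
  have h : ContDiff ℝ (⊤ : ℕ∞)
      (fun x : ℝ × ℝ => fderiv ℝ (fun x : ℝ × ℝ => f x.1 x.2) x (1, 0)) :=
    (ContDiff.fderiv_right hf (by simp)).clm_apply contDiff_const
  unfold Smooth2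
  have e : (fun x : ℝ × ℝ => pdu f x.1 x.2) = _ := funext fun x => hf.pdu_eq x.1 x.2
  exact e.symm ▸ h

theorem smooth_pdw (hf : Smooth2 f) : Smooth2 (pdw f) := by
  have h : ContDiff ℝ (⊤ : ℕ∞)
      (fun x : ℝ × ℝ => fderiv ℝ (fun x : ℝ × ℝ => f x.1 x.2) x (0, 1)) :=
    (ContDiff.fderiv_right hf (by simp)).clm_apply contDiff_const
  unfold Smooth2
  have e : (fun x : ℝ × ℝ => pdw f x.1 x.2) = _ := funext fun x => hf.pdw_eq x.1 x.2
  exact e.symm ▸ h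

theorem pdw_pdu (hf : Smooth2 f) : pdw (pdu f) = pdu (pdw f) := by
  funext u w
  have hd : DifferentiableAt ℝ (fderiv ℝ (fun x : ℝ × ℝ => f x.1 x.2)) (u, w) :=
    (ContDiff.fderiv_right (m := (⊤ : ℕ∞)) hf (by simp)).differentiable (by simp) _
  have hs : IsSymmSndFDerivAt ℝ (fun x : ℝ × ℝ => f x.1 x.2) (u, w) :=
    ContDiffAt.isSymmSndFDerivAt (ContDiff.contDiffAt hf) (by
      simpa using (by exact_mod_cast le_top : ((2 : ℕ∞) : WithTop ℕ∞) ≤ (⊤ : ℕ∞)))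
  rw [hf.smooth_pdu.pdw_eq, hf.smooth_pdw.pdu_eq]
  simp only [hf.pdu_eq, hf.pdw_eq, Prod.mk.eta]
  rw [fderiv_clm_apply hd (by fun_prop), fderiv_clm_apply hd (by fun_prop)]
  simpa using hs.eq _ _

theorem hasFDerivAt (hf : Smooth2 f) (x : ℝ × ℝ) :
    HasFDerivAt (fun x : ℝ × ℝ => f x.1 x.2)
      (pdu f x.1 x.2 • ContinuousLinearMap.fst ℝ ℝ ℝ +
        pdw f x.1 x.2 • ContinuousLinearMap.snd ℝ ℝ ℝ) x := by
  convert (hf.differentiable x).hasFDerivAt using 1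
  ext <;> simp [hf.pdu_eq, hf.pdw_eq]

theorem hasDerivAt (hf : Smooth2 f) {a b : ℝ → ℝ} {a' b' t : ℝ} (ha : HasDerivAt a a' t)
    (hb : HasDerivAt b b' t) :
    HasDerivAt (fun t => f (a t) (b t))
      (pdu f (a t) (b t) * a' + pdw f (a t) (b t) * b') t := by
  have h := (hf.hasFDerivAt (a t, b t)).comp_hasDerivAt t (ha.prodMk hb)
  exact h.congr_deriv (by simp)

end Smooth2

/-- Hadamard's lemma in the second variable. -/
theorem Smooth2.exists_eq_add_mul {f : ℝ → ℝ → ℝ} (hf : Smooth2 f) :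
    ∃ k : ℝ → ℝ → ℝ, Smooth2 k ∧ ∀ u v, f u v = f u 0 + v * k u v := by
  refine ⟨fun u v => ∫ s in (0 : ℝ)..1, pdw f u (s * v), ?_, fun u v => ?_⟩
  · have h : ContDiff ℝ (⊤ : ℕ∞) (fun x : (ℝ × ℝ) × ℝ => pdw f x.1.1 (x.2 * x.1.2)) :=
      ContDiff.comp (g := fun x : ℝ × ℝ => pdw f x.1 x.2) hf.smooth_pdw
        (by fun_prop : ContDiff ℝ (⊤ : ℕ∞) fun x : (ℝ × ℝ) × ℝ => (x.1.1, x.2 * x.1.2))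
    exact contDiff_integral_param h
  · have hd (s : ℝ) : HasDerivAt (fun s => f u (s * v)) (v * pdw f u (s * v)) s := by
      have := hf.hasDerivAt (hasDerivAt_const s u) ((hasDerivAt_id s).mul_const v)
      simpa [mul_comm] using this
    have hc : Continuous fun s => v * pdw f u (s * v) :=
      continuous_const.mul ((ContDiff.continuous hf.smooth_pdw).comp
        (by fun_prop : Continuous fun s : ℝ => ((u, s * v) : ℝ × ℝ)))
    have h := intervalIntegral.integral_eq_sub_of_hasDerivAt (fun s _ => hd s)
      (hc.intervalIntegrable 0 1)
    rw [intervalIntegral.integral_const_mul] at h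
    simp only [one_mul, zero_mul] at h
    linarith

theorem ContDiff.exists_eq_add_mul {h : ℝ → ℝ} (hh : ContDiff ℝ (⊤ : ℕ∞) h) :
    ∃ k : ℝ → ℝ, ContDiff ℝ (⊤ : ℕ∞) k ∧ ∀ t, h t = h 0 + t * k t := by
  have hf : Smooth2 fun _ t => h t := hh.comp contDiff_snd
  obtain ⟨k, hk, hk'⟩ := hf.exists_eq_add_mul
  exact ⟨k 0, ContDiff.comp (g := fun x : ℝ × ℝ => k x.1 x.2) hk (contDiff_prodMk_right 0), hk' 0⟩

theorem deriv_add_mul {k : ℝ → ℝ} (hk : ContDiff ℝ (⊤ : ℕ∞) k) {h : ℝ → ℝ} {c : ℝ}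
    (hh : ∀ t, h t = c + t * k t) :
    deriv h 0 = k 0 ∧ deriv (deriv h) 0 = 2 * deriv k 0 ∧
      deriv (deriv (deriv h)) 0 = 3 * deriv (deriv k) 0 := by
  have hd {g : ℝ → ℝ} (hg : ContDiff ℝ (⊤ : ℕ∞) g) (t : ℝ) : HasDerivAt g (deriv g t) t :=
    (hg.differentiable (by simp) t).hasDerivAt
  have hk1 : ContDiff ℝ (⊤ : ℕ∞) (deriv k) := (contDiff_infty_iff_deriv.1 hk).2
  have hk2 : ContDiff ℝ (⊤ : ℕ∞) (deriv (deriv k)) := (contDiff_infty_iff_deriv.1 hk1).2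
  have e0 : h = fun t => c + t * k t := funext hh
  have e1 : deriv h = fun t => k t + t * deriv k t := by
    funext t
    rw [e0]
    simpa using (((hasDerivAt_id t).mul (hd hk t)).const_add c).deriv
  have e2 : deriv (deriv h) = fun t => 2 * deriv k t + t * deriv (deriv k) t := by
    funext t
    rw [e1]
    refine HasDerivAt.deriv (((hd hk t).add ((hasDerivAt_id t).mul (hd hk1 t))).congr_deriv ?_)
    simp only [id_eq]
    ring
  have e3 : deriv (deriv (deriv h)) 0 = 3 * deriv (deriv k) 0 := by
    rw [e2]
    refine HasDerivAt.deriv ((((hd hk1 0).const_mul 2).add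
      ((hasDerivAt_id 0).mul (hd hk2 0))).congr_deriv ?_)
    ring
  exact ⟨by simp [e1], by simp [e2], e3⟩

theorem exists_contDiff_eventuallyEq_s15 {g : ℝ → ℝ} {T : Set ℝ} (hT : IsOpen T) {x : ℝ} (hx : x ∈ T)
    (hg : ContDiffOn ℝ (⊤ : ℕ∞) g T) :
    ∃ G : ℝ → ℝ, ContDiff ℝ (⊤ : ℕ∞) G ∧ G =ᶠ[𝓝 x] g := by
  obtain ⟨r, hr, hrT⟩ := Metric.isOpen_iff.1 hT x hx
  let χ : ContDiffBump x := ⟨r / 4, r / 2, by positivity, by linarith⟩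
  refine ⟨fun t => χ t * g t, contDiff_iff_contDiffAt.2 fun t => ?_, ?_⟩
  · by_cases ht : t ∈ T
    · exact χ.contDiffAt.mul (hg.contDiffAt (hT.mem_nhds ht))
    · have h0 : (fun t => χ t * g t) =ᶠ[𝓝 t] fun _ => 0 := by
        have hmem : (Metric.closedBall x (r / 2))ᶜ ∈ 𝓝 t := by
          refine Metric.isClosed_closedBall.isOpen_compl.mem_nhds fun h => ht (hrT ?_)
          exact Metric.closedBall_subset_ball (by linarith) h
        filter_upwards [hmem] with s hs
        have : χ s = 0 := χ.zero_of_le_dist (by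
          simp only [mem_compl_iff, Metric.mem_closedBall, not_le] at hs
          exact hs.le)
        simp [this]
      exact contDiffAt_const.congr_of_eventuallyEq h0
  · filter_upwards [χ.eventuallyEq_one] with t ht
    simp [ht]

theorem exists_smooth_local_inverse {E : Type*} [NormedAddCommGroup E] [NormedSpace ℝ E]
    [FiniteDimensional ℝ E] [CompleteSpace E] {F : E → E} {W : Set E} {x : E} (hW : IsOpen W)
    (hx : x ∈ W) (hF : ContDiffOn ℝ (⊤ : ℕ∞) F W) {A : E →L[ℝ] E} (hA : HasFDerivAt F A x)
    (hinj : ∀ v, A v = 0 → v = 0) :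
    ∃ (U V : Set E) (ψ : E → E), IsOpen U ∧ IsOpen V ∧ x ∈ U ∧ F x ∈ V ∧ U ⊆ W ∧
      ContDiffOn ℝ (⊤ : ℕ∞) ψ V ∧ MapsTo F U V ∧ MapsTo ψ V U ∧
      (∀ y ∈ U, ψ (F y) = y) ∧ (∀ z ∈ V, F (ψ z) = z) := by
  have hinj' : Function.Injective (A : E →ₗ[ℝ] E) :=
    (injective_iff_map_eq_zero (A : E →ₗ[ℝ] E)).2 hinj
  let e : E ≃L[ℝ] E := (LinearEquiv.ofInjectiveEndo _ hinj').toContinuousLinearEquiv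
  have he : (e : E →L[ℝ] E) = A := by
    ext v
    rfl
  have hFx : ContDiffAt ℝ (⊤ : ℕ∞) F x := hF.contDiffAt (hW.mem_nhds hx)
  have hAe : HasFDerivAt F (e : E →L[ℝ] E) x := he ▸ hA
  let P := hFx.toOpenPartialHomeomorph F hAe (by simp)
  have hPF : ⇑P = F := hFx.toOpenPartialHomeomorph_coe hAe (by simp)
  let S : Set E := W ∩ fderiv ℝ F ⁻¹' range ((↑) : (E ≃L[ℝ] E) → E →L[ℝ] E)
  have hS : IsOpen S :=
    (hF.continuousOn_fderiv_of_isOpen hW (by simp)).isOpen_inter_preimage hW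
      ContinuousLinearEquiv.isOpen
  have hxS : x ∈ S := ⟨hx, e, hAe.fderiv.symm⟩
  let Q := P.restrOpen S hS
  have hQF : ⇑Q = F := hPF
  have hQs : Q.source = P.source ∩ S := P.restrOpen_source S hS
  have hxQ : x ∈ Q.source := hQs ▸ ⟨hFx.mem_toOpenPartialHomeomorph_source hAe (by simp), hxS⟩
  refine ⟨Q.source, Q.target, Q.symm, Q.open_source, Q.open_target, hxQ,
    hQF ▸ Q.map_source hxQ, fun y hy => (hQs ▸ hy : y ∈ P.source ∩ S).2.1, ?_,
    hQF ▸ Q.mapsTo, Q.symm.mapsTo, fun y hy => hQF ▸ Q.left_inv hy,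
    fun z hz => hQF ▸ Q.right_inv hz⟩
  intro z hz
  have hy : Q.symm z ∈ S := (hQs ▸ Q.map_target hz : Q.symm z ∈ P.source ∩ S).2
  obtain ⟨e', he'⟩ := hy.2
  have hFy : ContDiffAt ℝ (⊤ : ℕ∞) F (Q.symm z) := hF.contDiffAt (hW.mem_nhds hy.1)
  refine (Q.contDiffAt_symm hz (f₀' := e') ?_ (hQF ▸ hFy)).contDiffWithinAt
  rw [he', hQF]
  exact (hFy.differentiableAt (by simp)).hasFDerivAt

theorem ContDiffOn.hasDerivAt_smooth {a : ℝ → ℝ} {S : Set ℝ} (hS : IsOpen S)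
    (ha : ContDiffOn ℝ (⊤ : ℕ∞) a S) {t : ℝ} (ht : t ∈ S) : HasDerivAt a (deriv a t) t :=
  ((ha.contDiffAt (hS.mem_nhds ht)).differentiableAt (by simp)).hasDerivAt

theorem ContDiffOn.deriv_smooth {a : ℝ → ℝ} {S : Set ℝ} (hS : IsOpen S)
    (ha : ContDiffOn ℝ (⊤ : ℕ∞) a S) : ContDiffOn ℝ (⊤ : ℕ∞) (deriv a) S :=
  ha.deriv_of_isOpen hS (by simp)

/-- Derivatives up to order three at `0` of a function along a curve through `0`, when the
first derivatives and the `uu` and `uw` derivatives of the function vanish at the origin. -/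
theorem Smooth2.deriv_comp_curve {f : ℝ → ℝ → ℝ} (hf : Smooth2 f) (hu : pdu f 0 0 = 0)
    (hw : pdw f 0 0 = 0) (huu : pdu (pdu f) 0 0 = 0) (huw : pdu (pdw f) 0 0 = 0)
    {a b : ℝ → ℝ} {S : Set ℝ} (hS : IsOpen S) (h0 : (0 : ℝ) ∈ S)
    (ha : ContDiffOn ℝ (⊤ : ℕ∞) a S) (hb : ContDiffOn ℝ (⊤ : ℕ∞) b S)
    (ha0 : a 0 = 0) (hb0 : b 0 = 0) :
    deriv (fun t => f (a t) (b t)) 0 = 0 ∧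
      deriv (deriv (fun t => f (a t) (b t))) 0 = pdw (pdw f) 0 0 * deriv b 0 ^ 2 ∧
      (deriv b 0 = 0 → deriv (deriv (deriv (fun t => f (a t) (b t)))) 0 =
        pdu (pdu (pdu f)) 0 0 * deriv a 0 ^ 3) := by
  have ha1 := ha.deriv_smooth hS
  have hb1 := hb.deriv_smooth hS
  have ha2 := ha1.deriv_smooth hS
  have hb2 := hb1.deriv_smooth hS
  have e1 : ∀ t ∈ S, HasDerivAt (fun t => f (a t) (b t))
      (pdu f (a t) (b t) * deriv a t + pdw f (a t) (b t) * deriv b t) t := fun t ht =>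
    hf.hasDerivAt (ha.hasDerivAt_smooth hS ht) (hb.hasDerivAt_smooth hS ht)
  have E1 : deriv (fun t => f (a t) (b t)) =ᶠ[𝓝 0]
      fun t => pdu f (a t) (b t) * deriv a t + pdw f (a t) (b t) * deriv b t := by
    filter_upwards [hS.mem_nhds h0] with t ht using (e1 t ht).deriv
  have along {g : ℝ → ℝ → ℝ} (hg : Smooth2 g) {t : ℝ} (ht : t ∈ S) :=
    hg.hasDerivAt (ha.hasDerivAt_smooth hS ht) (hb.hasDerivAt_smooth hS ht)
  have e2 : ∀ t ∈ S, HasDerivAt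
      (fun t => pdu f (a t) (b t) * deriv a t + pdw f (a t) (b t) * deriv b t)
      (pdu (pdu f) (a t) (b t) * deriv a t ^ 2 +
        2 * (pdu (pdw f) (a t) (b t) * (deriv a t * deriv b t)) +
        pdw (pdw f) (a t) (b t) * deriv b t ^ 2 +
        pdu f (a t) (b t) * deriv (deriv a) t + pdw f (a t) (b t) * deriv (deriv b) t) t := by
    intro t ht
    refine (((along hf.smooth_pdu ht).mul (ha1.hasDerivAt_smooth hS ht)).add
      ((along hf.smooth_pdw ht).mul (hb1.hasDerivAt_smooth hS ht))).congr_deriv ?_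
    rw [hf.pdw_pdu]
    ring
  have E2 : deriv (deriv (fun t => f (a t) (b t))) =ᶠ[𝓝 0]
      fun t => pdu (pdu f) (a t) (b t) * deriv a t ^ 2 +
        2 * (pdu (pdw f) (a t) (b t) * (deriv a t * deriv b t)) +
        pdw (pdw f) (a t) (b t) * deriv b t ^ 2 +
        pdu f (a t) (b t) * deriv (deriv a) t + pdw f (a t) (b t) * deriv (deriv b) t := by
    refine E1.deriv.trans ?_
    filter_upwards [hS.mem_nhds h0] with t ht using (e2 t ht).deriv
  refine ⟨?_, ?_, fun hb' => ?_⟩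
  · rw [E1.eq_of_nhds]
    simp [ha0, hb0, hu, hw]
  · rw [E2.eq_of_nhds]
    simp [ha0, hb0, hu, hw, huu, huw]
  · rw [E2.deriv_eq]
    have dA := ha1.hasDerivAt_smooth hS h0
    have dB := hb1.hasDerivAt_smooth hS h0
    have h := (((((along hf.smooth_pdu.smooth_pdu h0).mul (dA.pow 2)).add
      (((along hf.smooth_pdw.smooth_pdu h0).mul (dA.mul dB)).const_mul 2)).add
      ((along hf.smooth_pdw.smooth_pdw h0).mul (dB.pow 2))).add
      ((along hf.smooth_pdu h0).mul (ha2.hasDerivAt_smooth hS h0))).add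
      ((along hf.smooth_pdw h0).mul (hb2.hasDerivAt_smooth hS h0))
    refine (h.congr_deriv ?_).deriv
    simp only [Pi.mul_apply, Pi.pow_apply, ha0, hb0, hu, hw, huu, huw, hb', hf.pdw_pdu]
    ring

theorem MongeForm.smooth {f : ℝ → ℝ → ℝ} {k₂ : ℝ} (hM : MongeForm f k₂) : Smooth2 f := hM.1

theorem MongeForm.deriv_comp_curve {f : ℝ → ℝ → ℝ} {k₂ : ℝ} (hM : MongeForm f k₂)
    {a b : ℝ → ℝ} {S : Set ℝ} (hS : IsOpen S) (h0 : (0 : ℝ) ∈ S)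
    (ha : ContDiffOn ℝ (⊤ : ℕ∞) a S) (hb : ContDiffOn ℝ (⊤ : ℕ∞) b S)
    (ha0 : a 0 = 0) (hb0 : b 0 = 0) :
    deriv (fun t => f (a t) (b t)) 0 = 0 ∧
      deriv (deriv (fun t => f (a t) (b t))) 0 = k₂ * deriv b 0 ^ 2 ∧
      (deriv b 0 = 0 → deriv (deriv (deriv (fun t => f (a t) (b t)))) 0 =
        pd 3 0 f 0 0 * deriv a 0 ^ 3) := by
  obtain ⟨hf, -, hu, hw, huu, huw, hww, -⟩ := hM
  have h := Smooth2.deriv_comp_curve hf hu hw huu huw hS h0 ha hb ha0 hb0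
  rwa [show pdw (pdw f) 0 0 = k₂ from hww] at h

/-- An `A₂` singularity of a parabolic Monge form has nonzero cubic coefficient along the
kernel of its Hessian. -/
theorem MongeForm.pd_three_ne_zero {f : ℝ → ℝ → ℝ} {k₂ : ℝ} (hM : MongeForm f k₂)
    (hA : HasAkSingAt f 2) : pd 3 0 f 0 0 ≠ 0 := by
  obtain ⟨U, V, φ, ψ, ε₁, ε₂, hU, -, h0U, -, hφ, -, -, -, -, -, hφ0, -, hε₂, hfφ⟩ := hA
  have hk₂ : k₂ ≠ 0 := hM.2.2.2.2.2.2.2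
  let S : Set ℝ := (fun t : ℝ => ((0, t) : ℝ × ℝ)) ⁻¹' U
  have hS : IsOpen S := hU.preimage (by fun_prop)
  have h0S : (0 : ℝ) ∈ S := h0U
  have hγ : ContDiffOn ℝ (⊤ : ℕ∞) (fun t : ℝ => φ (0, t)) S :=
    hφ.comp (by fun_prop : ContDiff ℝ (⊤ : ℕ∞) fun t : ℝ => ((0, t) : ℝ × ℝ)).contDiffOn
      fun t ht => ht
  obtain ⟨-, h2, h3⟩ := hM.deriv_comp_curve hS h0S hγ.fst hγ.snd (by simp [hφ0]) (by simp [hφ0])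
  have hE : (fun t : ℝ => f (φ (0, t)).1 (φ (0, t)).2) =ᶠ[𝓝 0] fun t => f 0 0 + ε₂ * t ^ 3 := by
    filter_upwards [hS.mem_nhds h0S] with t ht
    rw [hfφ _ ht]
    simp
  have d1 : deriv (fun t : ℝ => f 0 0 + ε₂ * t ^ 3) = fun t => ε₂ * (3 * t ^ 2) := by
    funext t
    simp
  have d2 : deriv (fun t : ℝ => ε₂ * (3 * t ^ 2)) = fun t => ε₂ * (3 * (2 * t)) := by
    funext t
    simp
  have d3 : deriv (fun t : ℝ => ε₂ * (3 * (2 * t))) 0 = ε₂ * 6 := by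
    refine (((((hasDerivAt_id (0 : ℝ)).const_mul 2).const_mul 3).const_mul ε₂).congr_deriv ?_).deriv
    ring
  rw [hE.deriv.deriv_eq, d1, d2] at h2
  rw [hE.deriv.deriv.deriv_eq, d1, d2, d3] at h3
  have hb : deriv (fun t => (φ (0, t)).2) 0 = 0 := by
    simpa [hk₂] using h2.symm
  intro h
  have := h3 hb
  rw [h, zero_mul] at this
  rcases hε₂ with rfl | rfl <;> norm_num at this

/-- The critical points of `f(u, ·)` near the origin form a smooth graph. -/
theorem Smooth2.exists_critical_graph {f : ℝ → ℝ → ℝ} (hf : Smooth2 f) (hw : pdw f 0 0 = 0)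
    (huw : pdu (pdw f) 0 0 = 0) (hww : pdw (pdw f) 0 0 ≠ 0) :
    ∃ g : ℝ → ℝ, ContDiff ℝ (⊤ : ℕ∞) g ∧ g 0 = 0 ∧ deriv g 0 = 0 ∧
      ∀ᶠ u in 𝓝 0, pdw f u (g u) = 0 := by
  let F : ℝ × ℝ → ℝ × ℝ := fun x => (x.1, pdw f x.1 x.2)
  have hF : ContDiff ℝ (⊤ : ℕ∞) F := contDiff_fst.prodMk hf.smooth_pdw
  have hA := hasFDerivAt_fst.prodMk (hf.smooth_pdw.hasFDerivAt (0, 0))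
  obtain ⟨U, V, ψ, -, hV, h0U, h0V, -, hψ, -, -, hψF, hFψ⟩ :=
    exists_smooth_local_inverse (F := F) (x := (0, 0)) isOpen_univ (mem_univ _) hF.contDiffOn hA
      (by
        rintro ⟨v₁, v₂⟩ hv
        simp [huw, hww] at hv
        simp [hv])
  have hF0 : F (0, 0) = (0, 0) := by simp [F, hw]
  rw [hF0] at h0V
  let T : Set ℝ := (fun u : ℝ => ((u, 0) : ℝ × ℝ)) ⁻¹' V
  have hT : IsOpen T := hV.preimage (by fun_prop)
  have h0T : (0 : ℝ) ∈ T := h0V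
  have hg₀ : ContDiffOn ℝ (⊤ : ℕ∞) (fun u : ℝ => (ψ (u, 0)).2) T :=
    (hψ.comp (by fun_prop : ContDiff ℝ (⊤ : ℕ∞) fun u : ℝ => ((u, 0) : ℝ × ℝ)).contDiffOn
      fun t ht => ht).snd
  obtain ⟨g, hg, hgg⟩ := exists_contDiff_eventuallyEq_s15 hT h0T hg₀
  have hg0 : g 0 = 0 := by
    rw [hgg.eq_of_nhds, ← hF0, hψF _ h0U]
  have hcrit : ∀ᶠ u in 𝓝 0, pdw f u (g u) = 0 := by
    filter_upwards [hgg, hT.mem_nhds h0T] with u hu huT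
    have h := hFψ (u, 0) huT
    simp only [F, Prod.mk.injEq] at h
    rw [hu]
    have h2 := h.2
    rwa [h.1] at h2
  refine ⟨g, hg, hg0, ?_, hcrit⟩
  have hd := hf.smooth_pdw.hasDerivAt (hasDerivAt_id (0 : ℝ))
    (hg.differentiable (by simp) 0).hasDerivAt
  have hc0 : (fun u => pdw f (id u) (g u)) =ᶠ[𝓝 0] fun _ => 0 := hcrit
  have := hd.deriv
  rw [hc0.deriv_eq] at this
  simpa [hg0, huw, hww] using this

/-- Splitting off the square near a graph of nondegenerate critical points. -/
theorem Smooth2.exists_split {f : ℝ → ℝ → ℝ} (hf : Smooth2 f) {g : ℝ → ℝ}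
    (hg : ContDiff ℝ (⊤ : ℕ∞) g) :
    ∃ q : ℝ → ℝ → ℝ, Smooth2 q ∧ 2 * q 0 (g 0) = pdw (pdw f) 0 (g 0) ∧
      ∀ u, pdw f u (g u) = 0 → ∀ w, f u w = f u (g u) + (w - g u) ^ 2 * q u w := by
  let G : ℝ → ℝ → ℝ := fun u v => f u (g u + v)
  have hG : Smooth2 G := ContDiff.comp (g := fun x : ℝ × ℝ => f x.1 x.2) hf
    (contDiff_fst.prodMk ((hg.comp contDiff_fst).add contDiff_snd))
  obtain ⟨k, hk, hGk⟩ := hG.exists_eq_add_mul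
  obtain ⟨q, hq, hkq⟩ := hk.exists_eq_add_mul
  have slice {h : ℝ → ℝ → ℝ} (hh : Smooth2 h) (u : ℝ) : ContDiff ℝ (⊤ : ℕ∞) (h u) :=
    ContDiff.comp (g := fun x : ℝ × ℝ => h x.1 x.2) hh (contDiff_prodMk_right u)
  have dG (u : ℝ) : deriv (G u) = fun v => pdw f u (g u + v) := by
    funext v
    have := (hf.hasDerivAt (hasDerivAt_const v u) ((hasDerivAt_id v).const_add (g u))).deriv
    simpa using this
  have ddG (u : ℝ) : deriv (deriv (G u)) = fun v => pdw (pdw f) u (g u + v) := by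
    rw [dG]
    funext v
    have := (hf.smooth_pdw.hasDerivAt (hasDerivAt_const v u)
      ((hasDerivAt_id v).const_add (g u))).deriv
    simpa using this
  refine ⟨fun u w => q u (w - g u), ?_, ?_, fun u hu w => ?_⟩
  · exact ContDiff.comp (g := fun x : ℝ × ℝ => q x.1 x.2) hq
      (contDiff_fst.prodMk (contDiff_snd.sub (hg.comp contDiff_fst)))
  · have h1 := (deriv_add_mul (slice hk 0) (hGk 0)).2.1
    rw [(deriv_add_mul (slice hq 0) (hkq 0)).1, ddG] at h1
    simpa using h1.symm
  · have h1 := (deriv_add_mul (slice hk u) (hGk u)).1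
    rw [dG] at h1
    simp only [add_zero, hu] at h1
    have h2 := hGk u (w - g u)
    rw [hkq, ← h1] at h2
    simp only [G, add_sub_cancel, add_zero] at h2
    rw [h2]
    ring

theorem exists_eq_cube_mul {h : ℝ → ℝ} (hh : ContDiff ℝ (⊤ : ℕ∞) h) (h0 : h 0 = 0)
    (h1 : deriv h 0 = 0) (h2 : deriv (deriv h) 0 = 0) :
    ∃ n : ℝ → ℝ, ContDiff ℝ (⊤ : ℕ∞) n ∧ 6 * n 0 = deriv (deriv (deriv h)) 0 ∧
      ∀ t, h t = t ^ 3 * n t := by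
  obtain ⟨k, hk, hk'⟩ := hh.exists_eq_add_mul
  obtain ⟨m, hm, hm'⟩ := hk.exists_eq_add_mul
  obtain ⟨n, hn, hn'⟩ := hm.exists_eq_add_mul
  obtain ⟨a1, a2, a3⟩ := deriv_add_mul hk hk'
  obtain ⟨b1, b2, -⟩ := deriv_add_mul hm hm'
  obtain ⟨c1, -, -⟩ := deriv_add_mul hn hn'
  refine ⟨n, hn, by linarith, fun t => ?_⟩
  have hk0 : k 0 = 0 := by linarith
  have hm0 : m 0 = 0 := by linarith
  rw [hk' t, hm' t, hn' t, h0, hk0, hm0]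
  ring

theorem exists_sign_mul_pos {x : ℝ} (hx : x ≠ 0) : ∃ σ : ℝ, (σ = 1 ∨ σ = -1) ∧ 0 < σ * x := by
  rcases hx.lt_or_gt with h | h
  · exact ⟨-1, Or.inr rfl, by linarith⟩
  · exact ⟨1, Or.inl rfl, by linarith⟩

/-- A function of the form `(w - g(u))² q(u,w) + u³ n(u)` with `q`, `n` nonvanishing at the origin
has an `A₂` singularity there. -/
theorem hasAkSingAt_two_of_eventually_eq {f q : ℝ → ℝ → ℝ} {g n : ℝ → ℝ}
    (hg : ContDiff ℝ (⊤ : ℕ∞) g) (hg0 : g 0 = 0) (hg1 : deriv g 0 = 0) (hq : Smooth2 q)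
    (hn : ContDiff ℝ (⊤ : ℕ∞) n) (hq0 : q 0 0 ≠ 0) (hn0 : n 0 ≠ 0)
    (hf : ∀ᶠ u in 𝓝 0, ∀ w, f u w = f 0 0 + (w - g u) ^ 2 * q u w + u ^ 3 * n u) :
    HasAkSingAt f 2 := by
  obtain ⟨σ, hσ, hσq⟩ := exists_sign_mul_pos hq0
  obtain ⟨τ, hτ, hτn⟩ := exists_sign_mul_pos hn0
  obtain ⟨T, hT, hTo, h0T⟩ := eventually_nhds_iff.1 hf
  let Q : ℝ × ℝ → ℝ := fun x => σ * q x.1 x.2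
  let N : ℝ × ℝ → ℝ := fun x => τ * n x.1
  have hQ : ContDiff ℝ (⊤ : ℕ∞) Q := contDiff_const.mul hq
  have hN : ContDiff ℝ (⊤ : ℕ∞) N := contDiff_const.mul (hn.comp contDiff_fst)
  let W : Set (ℝ × ℝ) := Prod.fst ⁻¹' T ∩ (Q ⁻¹' Ioi 0 ∩ N ⁻¹' Ioi 0)
  have hW : IsOpen W := (hTo.preimage continuous_fst).inter
    ((isOpen_Ioi.preimage hQ.continuous).inter (isOpen_Ioi.preimage hN.continuous))
  have h0W : ((0, 0) : ℝ × ℝ) ∈ W := ⟨h0T, hσq, hτn⟩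
  let R : ℝ × ℝ → ℝ := fun x => √(Q x)
  let C : ℝ × ℝ → ℝ := fun x => N x ^ (1 / 3 : ℝ)
  have hR : ContDiffOn ℝ (⊤ : ℕ∞) R W := hQ.contDiffOn.sqrt fun x hx => (ne_of_gt hx.2.1)
  have hC : ContDiffOn ℝ (⊤ : ℕ∞) C W :=
    hN.contDiffOn.rpow_const_of_ne fun x hx => (ne_of_gt hx.2.2)
  have hR0 : R (0, 0) ≠ 0 := (Real.sqrt_pos.2 hσq).ne'
  have hC0 : C (0, 0) ≠ 0 := (Real.rpow_pos_of_pos hτn _).ne'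
  let F : ℝ × ℝ → ℝ × ℝ := fun x => ((x.2 - g x.1) * R x, x.1 * C x)
  have hF : ContDiffOn ℝ (⊤ : ℕ∞) F W :=
    ((contDiff_snd.sub (hg.comp contDiff_fst)).contDiffOn.mul hR).prodMk
      (contDiff_fst.contDiffOn.mul hC)
  have dR := ((hR.contDiffAt (hW.mem_nhds h0W)).differentiableAt (by simp)).hasFDerivAt
  have dC := ((hC.contDiffAt (hW.mem_nhds h0W)).differentiableAt (by simp)).hasFDerivAt
  have dg := (hg.differentiable (by simp) 0).hasDerivAt.comp_hasFDerivAt ((0, 0) : ℝ × ℝ)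
    (hasFDerivAt_fst (𝕜 := ℝ) (E := ℝ) (F := ℝ))
  have hA := ((hasFDerivAt_snd.sub dg).mul dR).prodMk (hasFDerivAt_fst.mul dC)
  obtain ⟨U, V, ψ, hU, hV, h0U, h0V, hUW, hψ, hFUV, hψVU, hψF, hFψ⟩ :=
    exists_smooth_local_inverse (F := F) hW h0W hF hA
      (by
        rintro ⟨v₁, v₂⟩ hv
        simp [hg0, hg1, hR0, hC0] at hv
        simp [hv])
  have hF0 : F (0, 0) = (0, 0) := by simp [F, hg0]
  rw [hF0] at h0V
  refine ⟨V, U, ψ, F, σ, τ, hV, hU, h0V, h0U, hψ, hF.mono hUW, hψVU, hFUV, hFψ, hψF,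
    by simpa only [hF0] using hψF _ h0U, hσ, hτ, fun x hx => ?_⟩
  have hy := hUW (hψVU hx)
  have hxy := hFψ x hx
  generalize ψ x = y at hy hxy
  subst hxy
  have hR2 : R y ^ 2 = σ * q y.1 y.2 := Real.sq_sqrt (le_of_lt hy.2.1)
  have hC3 : C y ^ 3 = τ * n y.1 := by
    have : C y ^ 3 = N y := by
      simp only [C]
      rw [← Real.rpow_natCast, ← Real.rpow_mul (le_of_lt hy.2.2)]
      norm_num
    exact this
  have hσ2 : σ * σ = 1 := by rcases hσ with rfl | rfl <;> norm_num
  have hτ2 : τ * τ = 1 := by rcases hτ with rfl | rfl <;> norm_num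
  rw [hT y.1 hy.1]
  simp only [F, mul_pow, hR2, Nat.reduceAdd, hC3]
  linear_combination (-(y.2 - g y.1) ^ 2 * q y.1 y.2) * hσ2 - (y.1 ^ 3 * n y.1) * hτ2

theorem MongeForm.hasAkSingAt_two {f : ℝ → ℝ → ℝ} {k₂ : ℝ} (hM : MongeForm f k₂)
    (h30 : pd 3 0 f 0 0 ≠ 0) : HasAkSingAt f 2 := by
  have hf := hM.smooth
  obtain ⟨-, hf0, hu, hw, huu, huw, hww, hk₂⟩ := id hM
  have hww' : pdw (pdw f) 0 0 = k₂ := hww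
  obtain ⟨g, hg, hg0, hg1, hcrit⟩ := hf.exists_critical_graph hw huw (hww' ▸ hk₂)
  obtain ⟨q, hq, hq0, hfq⟩ := hf.exists_split hg
  have hh : ContDiff ℝ (⊤ : ℕ∞) fun u => f u (g u) :=
    ContDiff.comp (g := fun x : ℝ × ℝ => f x.1 x.2) hf (contDiff_id.prodMk hg)
  obtain ⟨h1, h2, h3⟩ := hM.deriv_comp_curve isOpen_univ (mem_univ _) contDiff_id.contDiffOn
    hg.contDiffOn rfl hg0
  simp only [id, hg1] at h1 h2 h3
  obtain ⟨n, hn, hn0, hhn⟩ := exists_eq_cube_mul hh (by simp [hg0, hf0]) h1 (by simpa using h2)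
  rw [hg0, hww'] at hq0
  have hn0' : 6 * n 0 = pd 3 0 f 0 0 := by
    rw [hn0, h3 trivial]
    simp
  refine hasAkSingAt_two_of_eventually_eq hg hg0 hg1 hq hn (fun h => hk₂ ?_) (fun h => h30 ?_) ?_
  · rw [← hq0, h, mul_zero]
  · rw [← hn0', h, mul_zero]
  · filter_upwards [hcrit] with u hu w
    rw [hfq u hu w, hhn u, hf0]
    ring

theorem deriv_triple {a b F : ℝ → ℝ} {S : Set ℝ} (hS : IsOpen S) (h0 : (0 : ℝ) ∈ S)
    (ha : ContDiffOn ℝ (⊤ : ℕ∞) a S) (hb : ContDiffOn ℝ (⊤ : ℕ∞) b S)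
    (hF : ContDiffOn ℝ (⊤ : ℕ∞) F S) :
    deriv (fun t => (a t, b t, F t)) 0 = (deriv a 0, deriv b 0, deriv F 0) ∧
      deriv (deriv fun t => (a t, b t, F t)) 0 =
        (deriv (deriv a) 0, deriv (deriv b) 0, deriv (deriv F) 0) ∧
      deriv (deriv (deriv fun t => (a t, b t, F t))) 0 =
        (deriv (deriv (deriv a)) 0, deriv (deriv (deriv b)) 0, deriv (deriv (deriv F)) 0) := by
  have key {a b F : ℝ → ℝ} (ha : ContDiffOn ℝ (⊤ : ℕ∞) a S) (hb : ContDiffOn ℝ (⊤ : ℕ∞) b S)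
      (hF : ContDiffOn ℝ (⊤ : ℕ∞) F S) :
      deriv (fun t => (a t, b t, F t)) =ᶠ[𝓝 0] fun t => (deriv a t, deriv b t, deriv F t) := by
    filter_upwards [hS.mem_nhds h0] with t ht
    exact ((ha.hasDerivAt_smooth hS ht).prodMk
      ((hb.hasDerivAt_smooth hS ht).prodMk (hF.hasDerivAt_smooth hS ht))).deriv
  have e1 := key ha hb hF
  have e2 := key (ha.deriv_smooth hS) (hb.deriv_smooth hS) (hF.deriv_smooth hS)
  have e3 := key ((ha.deriv_smooth hS).deriv_smooth hS) ((hb.deriv_smooth hS).deriv_smooth hS)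
    ((hF.deriv_smooth hS).deriv_smooth hS)
  exact ⟨e1.eq_of_nhds, (e1.deriv.trans e2).eq_of_nhds,
    ((e1.deriv.trans e2).deriv.trans e3).eq_of_nhds⟩

theorem inv_norm3_smul_eq_iff {x : ℝ × ℝ × ℝ} (hx : x ≠ 0) :
    ((norm3 x)⁻¹ • x = (0, 0, 1) ∨ (norm3 x)⁻¹ • x = (0, 0, -1)) ↔ x.1 = 0 ∧ x.2.1 = 0 := by
  obtain ⟨x₁, x₂, x₃⟩ := x
  have hpos : 0 < dot3 (x₁, x₂, x₃) (x₁, x₂, x₃) := by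
    simp only [dot3]
    by_contra! h
    refine hx ?_
    have h1 : x₁ = 0 := by nlinarith [mul_self_nonneg x₁, mul_self_nonneg x₂, mul_self_nonneg x₃]
    have h2 : x₂ = 0 := by nlinarith [mul_self_nonneg x₁, mul_self_nonneg x₂, mul_self_nonneg x₃]
    have h3 : x₃ = 0 := by nlinarith [mul_self_nonneg x₁, mul_self_nonneg x₂, mul_self_nonneg x₃]
    simp [h1, h2, h3]
  have hn : norm3 (x₁, x₂, x₃) ≠ 0 := (Real.sqrt_pos.2 hpos).ne'
  constructor
  · rintro (h | h) <;>
      simpa [hn, Prod.ext_iff] using And.intro (congrArg (·.1) h) (congrArg (·.2.1) h)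
  · rintro ⟨h1, h2⟩
    dsimp only at h1 h2
    subst h1 h2
    have h3 : x₃ ≠ 0 := fun h => hx (by simp [h])
    have hnorm : norm3 (0, 0, x₃) = |x₃| := by simp [norm3, dot3, Real.sqrt_mul_self_eq_abs]
    rw [hnorm]
    rcases h3.lt_or_gt with h | h
    · right
      simp [abs_of_neg h, inv_mul_cancel₀ h3]
    · left
      simp [abs_of_pos h, inv_mul_cancel₀ h3]

/-- The tangent direction at the origin of a curve in the parabolic set. -/
theorem MongeForm.tangent_parabolic_set {f : ℝ → ℝ → ℝ} {k₂ : ℝ} (hM : MongeForm f k₂)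
    {a b : ℝ → ℝ} {a₁ b₁ : ℝ} (ha : HasDerivAt a a₁ 0) (hb : HasDerivAt b b₁ 0)
    (ha0 : a 0 = 0) (hb0 : b 0 = 0) (hP : ∀ᶠ t in 𝓝 0, Pfun f (a t) (b t) = 0) :
    pd 3 0 f 0 0 * a₁ + pd 2 1 f 0 0 * b₁ = 0 := by
  have hf := hM.smooth
  obtain ⟨-, -, -, -, huu, huw, hww, hk₂⟩ := hM
  replace huu : pdu (pdu f) 0 0 = 0 := huu
  replace huw : pdu (pdw f) 0 0 = 0 := huw
  replace hww : pdw (pdw f) 0 0 = k₂ := hww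
  have h := (((hf.smooth_pdu.smooth_pdu.hasDerivAt ha hb).mul
    (hf.smooth_pdw.smooth_pdw.hasDerivAt ha hb)).sub
    ((hf.smooth_pdw.smooth_pdu.hasDerivAt ha hb).pow 2)).deriv
  have hP0 : ((fun t => pdu (pdu f) (a t) (b t)) * (fun t => pdw (pdw f) (a t) (b t)) -
      (fun t => pdu (pdw f) (a t) (b t)) ^ 2) =ᶠ[𝓝 0] fun _ => 0 := hP
  rw [hP0.deriv_eq, hf.smooth_pdu.pdw_pdu, hf.pdw_pdu] at h
  simp only [deriv_const, ha0, hb0, huu, huw, hww] at h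
  have h' : (pd 3 0 f 0 0 * a₁ + pd 2 1 f 0 0 * b₁) * k₂ = 0 := by
    change (pdu (pdu (pdu f)) 0 0 * a₁ + pdu (pdu (pdw f)) 0 0 * b₁) * k₂ = 0
    linear_combination -h
  exact (mul_eq_zero.1 h').resolve_right hk₂

/-- `f` does not have an `A₂` singularity at the origin iff the unit binormal
`b(0)` equals `±(0,0,1)`; moreover, in that case the torsion satisfies `τ(0) = 0`. -/
theorem monge_not_A2_iff_binormal (f : ℝ → ℝ → ℝ) (k₂ : ℝ) (hM : MongeForm f k₂)
    (hpar : ¬(pd 3 0 f 0 0 = 0 ∧ pd 2 1 f 0 0 = 0))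
    (ε : ℝ) (hε : 0 < ε) (c : ℝ → ℝ × ℝ) (hc : ContDiffOn ℝ (⊤ : ℕ∞) c (Set.Ioo (-ε) ε))
    (hc0 : c 0 = (0, 0)) (hc' : deriv c 0 ≠ (0, 0))
    (hP : ∀ t : ℝ, |t| < ε → Pfun f (c t).1 (c t).2 = 0) :
    let L : ℝ → ℝ × ℝ × ℝ := fun t => ((c t).1, (c t).2, f (c t).1 (c t).2)
    cross3 (deriv L 0) (deriv (deriv L) 0) ≠ 0 →
      ((¬HasAkSingAt f 2 ↔
          (binormal0 L = (((0 : ℝ), (0 : ℝ), (1 : ℝ)) : ℝ × ℝ × ℝ) ∨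
            binormal0 L = (((0 : ℝ), (0 : ℝ), (-1 : ℝ)) : ℝ × ℝ × ℝ))) ∧
        ((binormal0 L = (((0 : ℝ), (0 : ℝ), (1 : ℝ)) : ℝ × ℝ × ℝ) ∨
            binormal0 L = (((0 : ℝ), (0 : ℝ), (-1 : ℝ)) : ℝ × ℝ × ℝ)) →
          tor L 0 = 0)) := by
  intro L hN
  have hf := hM.smooth
  obtain ⟨-, -, -, -, huu, huw, hww, hk₂⟩ := id hM
  have h0S : (0 : ℝ) ∈ Ioo (-ε) ε := ⟨by linarith, hε⟩
  have ha : ContDiffOn ℝ (⊤ : ℕ∞) (fun t => (c t).1) (Ioo (-ε) ε) := hc.fst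
  have hb : ContDiffOn ℝ (⊤ : ℕ∞) (fun t => (c t).2) (Ioo (-ε) ε) := hc.snd
  have hF : ContDiffOn ℝ (⊤ : ℕ∞) (fun t => f (c t).1 (c t).2) (Ioo (-ε) ε) :=
    ContDiff.comp_contDiffOn (g := fun x : ℝ × ℝ => f x.1 x.2) hf hc
  obtain ⟨F1, F2, F3⟩ := hM.deriv_comp_curve isOpen_Ioo h0S ha hb (by simp [hc0]) (by simp [hc0])
  obtain ⟨L1, L2, L3⟩ := deriv_triple isOpen_Ioo h0S ha hb hF
  have hL1 : deriv L 0 = _ := L1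
  have hL2 : deriv (deriv L) 0 = _ := L2
  have hL3 : deriv (deriv (deriv L)) 0 = _ := L3
  have hc1 : deriv c 0 = (deriv (fun t => (c t).1) 0, deriv (fun t => (c t).2) 0) :=
    (((ha.hasDerivAt_smooth isOpen_Ioo h0S).prodMk
      (hb.hasDerivAt_smooth isOpen_Ioo h0S)) : HasDerivAt c _ 0).deriv
  have htan := hM.tangent_parabolic_set (ha.hasDerivAt_smooth isOpen_Ioo h0S)
    (hb.hasDerivAt_smooth isOpen_Ioo h0S) (by simp [hc0]) (by simp [hc0]) (by
      filter_upwards [isOpen_Ioo.mem_nhds h0S] with t ht using hP t (abs_lt.2 ht))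
  rw [F1] at hL1
  rw [F2] at hL2
  rw [hc1] at hc'
  set a₁ := deriv (fun t => (c t).1) 0
  set b₁ := deriv (fun t => (c t).2) 0
  have hb_iff : b₁ = 0 ↔ pd 3 0 f 0 0 = 0 := by
    constructor
    · intro h
      rw [h, mul_zero, add_zero] at htan
      exact (mul_eq_zero.1 htan).resolve_right fun h' => hc' (by rw [h, h'])
    · intro h
      rw [h, zero_mul, zero_add] at htan
      exact (mul_eq_zero.1 htan).resolve_left fun h' => hpar ⟨h, h'⟩
  have hbin : (binormal0 L = (0, 0, 1) ∨ binormal0 L = (0, 0, -1)) ↔ b₁ = 0 := by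
    unfold binormal0
    rw [inv_norm3_smul_eq_iff hN, hL1, hL2]
    simp only [cross3, zero_mul, sub_zero, zero_sub]
    constructor
    · rintro ⟨h, -⟩
      simpa [hk₂] using h
    · intro h
      simp [h]
  have hA2 : HasAkSingAt f 2 ↔ pd 3 0 f 0 0 ≠ 0 := ⟨hM.pd_three_ne_zero, hM.hasAkSingAt_two⟩
  refine ⟨by rw [hbin, hb_iff, hA2, not_not], fun h => ?_⟩
  have hb0 := hbin.1 h
  unfold tor
  rw [hL1, hL2, hL3, F3 hb0, hb_iff.1 hb0]
  simp [dot3, cross3, hb0]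
end
end
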